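/- Let ρ be a real number with √3/2 < ρ ≤ 1. Then for every set W ⊆ Q with |W| = 2 there exists a set B ⊆ Q with |B| = 2 such that μ({q ∈ Q : infDist(q, B) < infDist(q, W)}) > ρ/2. (Barney wins the two-point game whenever the aspect ratio exceeds √3/2.) -/

import Mathlib

open MeasureTheory Metric Set
open scoped ENNReal

/-- The point `(x, y)` in the Euclidean plane. -/
noncomputable def pt (x y : ℝ) : EuclideanSpace ℝ (Fin 2) :=
  (WithLp.equiv 2 (Fin 2 → ℝ)).symm ![x, y]

/-- The rectangular board `[0,1] × [0,ρ]`. -/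
def board (ρ : ℝ) : Set (EuclideanSpace ℝ (Fin 2)) :=
  {q | q 0 ∈ Set.Icc (0:ℝ) 1 ∧ q 1 ∈ Set.Icc (0:ℝ) ρ}

namespace VG

def D (z b : ℝ × ℝ) : ℝ := (z.1 - b.1) ^ 2 + (z.2 - b.2) ^ 2

def Q (A B : ℝ) : Set (ℝ × ℝ) := {z | (0 ≤ z.1 ∧ z.1 ≤ A) ∧ (0 ≤ z.2 ∧ z.2 ≤ B)}

def Win (A B : ℝ) (w1 w2 : ℝ × ℝ) : Prop :=
  ∃ b1 ∈ Q A B, ∃ b2 ∈ Q A B, ENNReal.ofReal (A * B / 2) <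
    volume {z : ℝ × ℝ | z ∈ Q A B ∧ ((D z b1 < D z w1 ∧ D z b1 < D z w2) ∨
      (D z b2 < D z w1 ∧ D z b2 < D z w2))}

lemma D_cont (b : ℝ × ℝ) : Continuous (fun z => D z b) := by
  unfold D; fun_prop

lemma Q_meas (A B : ℝ) : MeasurableSet (Q A B) := by
  have : Q A B = Icc 0 A ×ˢ Icc 0 B := by ext z; exact Iff.rfl
  rw [this]; measurability

lemma Q_vol (A B : ℝ) (hA : 0 ≤ A) : volume (Q A B) = ENNReal.ofReal (A * B) := by
  have : Q A B = Icc 0 A ×ˢ Icc 0 B := by ext z; exact Iff.rfl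
  rw [this, Measure.volume_eq_prod, Measure.prod_prod, Real.volume_Icc, Real.volume_Icc,
    ← ENNReal.ofReal_mul (by linarith)]
  simp

lemma line_null (u v c : ℝ) (h : u ≠ 0 ∨ v ≠ 0) :
    volume {z : ℝ × ℝ | u * z.1 + v * z.2 = c} = 0 := by
  have hm : MeasurableSet {z : ℝ × ℝ | u * z.1 + v * z.2 = c} :=
    measurableSet_eq_fun (by fun_prop) (by fun_prop)
  by_cases hv : v = 0
  · have hu : u ≠ 0 := by tauto
    have : {z : ℝ × ℝ | u * z.1 + v * z.2 = c} ⊆ ({c / u} : Set ℝ) ×ˢ (Set.univ : Set ℝ) := by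
      rintro z hz
      simp only [mem_ofPred_eq, hv] at hz
      simp only [Set.mem_prod, mem_singleton_iff, mem_univ, and_true]
      field_simp; linarith
    apply measure_mono_null this
    rw [Measure.volume_eq_prod, Measure.prod_prod]; simp
  · rw [Measure.volume_eq_prod, Measure.measure_prod_null hm]
    refine Filter.Eventually.of_forall fun x => ?_
    have : (Prod.mk x ⁻¹' {z : ℝ × ℝ | u * z.1 + v * z.2 = c}) ⊆ {(c - u * x) / v} := by
      intro y hy
      simp only [mem_preimage, mem_ofPred_eq] at hy
      simp only [mem_singleton_iff]
      field_simp; linarith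
    exact measure_mono_null this (by simp)

lemma area (x0 x1 f0 f1 g0 g1 : ℝ) (h : x0 ≤ x1) (h0 : f0 + f1 * x0 ≤ g0 + g1 * x0)
    (h1 : f0 + f1 * x1 ≤ g0 + g1 * x1) :
    volume {z : ℝ × ℝ | (x0 < z.1 ∧ z.1 < x1) ∧ (f0 + f1 * z.1 < z.2 ∧ z.2 < g0 + g1 * z.1)} =
      ENNReal.ofReal ((g0 - f0) * (x1 - x0) + (g1 - f1) * (x1 ^ 2 - x0 ^ 2) / 2) := by
  have key := volume_regionBetween_eq_integral (μ := volume) (f := fun x => f0 + f1 * x)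
    (g := fun x => g0 + g1 * x) (s := Ioo x0 x1)
    ((Continuous.integrableOn_Icc (by fun_prop)).mono_set Ioo_subset_Icc_self)
    ((Continuous.integrableOn_Icc (by fun_prop)).mono_set Ioo_subset_Icc_self) measurableSet_Ioo
    (by
      intro x hx
      obtain ⟨ha, hb⟩ := hx
      show f0 + f1 * x ≤ g0 + g1 * x
      have hd : 0 < x1 - x0 := by linarith
      by_contra hc
      push Not at hc
      nlinarith [mul_nonneg (sub_nonneg.2 h0) (sub_nonneg.2 hb.le),
        mul_nonneg (sub_nonneg.2 h1) (sub_nonneg.2 ha.le), mul_pos (sub_pos.2 hc) hd])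
  have e : {z : ℝ × ℝ | (x0 < z.1 ∧ z.1 < x1) ∧ (f0 + f1 * z.1 < z.2 ∧ z.2 < g0 + g1 * z.1)} =
      regionBetween (fun x => f0 + f1 * x) (fun x => g0 + g1 * x) (Ioo x0 x1) := rfl
  rw [e, Measure.volume_eq_prod, key]
  congr 1
  rw [← integral_Ioc_eq_integral_Ioo, ← intervalIntegral.integral_of_le h]
  have : ((fun x => g0 + g1 * x) - fun x => f0 + f1 * x) = fun x : ℝ => (g0 - f0) + (g1 - f1) * x := by
    ext x; simp only [Pi.sub_apply]; ring
  rw [this, intervalIntegral.integral_add (by simp) (Continuous.intervalIntegrable (by fun_prop) _ _),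
    intervalIntegral.integral_const_mul, integral_id]
  simp; ring

lemma Win.swap {A B : ℝ} {w1 w2 : ℝ × ℝ} (h : Win A B w1 w2) : Win A B w2 w1 := by
  obtain ⟨b1, h1, b2, h2, h⟩ := h
  refine ⟨b1, h1, b2, h2, lt_of_lt_of_le h (measure_mono ?_)⟩
  rintro z ⟨hz, hz'⟩
  exact ⟨hz, by tauto⟩

lemma win_meas (A B : ℝ) (b1 b2 w1 w2 : ℝ × ℝ) : MeasurableSet
    {z : ℝ × ℝ | z ∈ Q A B ∧ ((D z b1 < D z w1 ∧ D z b1 < D z w2) ∨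
      (D z b2 < D z w1 ∧ D z b2 < D z w2))} := by
  have l : ∀ b w, MeasurableSet {z : ℝ × ℝ | D z b < D z w} := fun b w =>
    measurableSet_lt (D_cont b).measurable (D_cont w).measurable
  exact (Q_meas A B).inter ((((l b1 w1).inter (l b1 w2))).union ((l b2 w1).inter (l b2 w2)))

lemma Win.transfer {A B A' B' : ℝ} {w1 w2 : ℝ × ℝ} (φ : ℝ × ℝ → ℝ × ℝ)
    (hφ : MeasurePreserving φ volume volume) (hφφ : ∀ z, φ (φ z) = z)
    (hQ : ∀ z, z ∈ Q A B → φ z ∈ Q A' B')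
    (_hQ' : ∀ z, z ∈ Q A' B' → φ z ∈ Q A B) (hD : ∀ z b, D (φ z) (φ b) = D z b)
    (hAB : A' * B' = A * B)
    (h : Win A B (φ w1) (φ w2)) : Win A' B' w1 w2 := by
  obtain ⟨b1, h1, b2, h2, h⟩ := h
  refine ⟨φ b1, hQ _ h1, φ b2, hQ _ h2, ?_⟩
  rw [hAB]
  refine lt_of_lt_of_le h ?_
  rw [← hφ.measure_preimage (win_meas _ _ _ _ _ _).nullMeasurableSet]
  apply measure_mono
  rintro z ⟨hz, hz'⟩
  simp only [hD] at hz'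
  have e1 : ∀ b, D z (φ b) = D (φ z) b := fun b => by rw [← hD z (φ b), hφφ]
  refine ⟨by simpa [hφφ] using hQ _ hz |> fun h => h, ?_⟩
  simpa only [e1, hD] using hz'

lemma Win.transpose {A B : ℝ} {w1 w2 : ℝ × ℝ} (h : Win B A w1.swap w2.swap) : Win A B w1 w2 := by
  refine Win.transfer (A := B) (B := A) Prod.swap Measure.measurePreserving_swap (by simp)
    ?_ ?_ ?_ (by ring) h
  · rintro z ⟨h1, h2⟩; exact ⟨h2, h1⟩
  · rintro z ⟨h1, h2⟩; exact ⟨h2, h1⟩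
  · intro z b; simp [D]; ring

lemma mp_sub (A : ℝ) : MeasurePreserving (fun x : ℝ => A - x) volume volume :=
  Measure.measurePreserving_sub_left volume A

lemma Win.reflx {A B : ℝ} {w1 w2 : ℝ × ℝ} (h : Win A B (A - w1.1, w1.2) (A - w2.1, w2.2)) :
    Win A B w1 w2 := by
  refine Win.transfer (A := A) (B := B) (fun z => (A - z.1, z.2))
    ((mp_sub A).prod (MeasurePreserving.id volume)) (by simp) ?_ ?_ ?_ (by ring) h
  · rintro z ⟨h1, h2⟩; exact ⟨⟨by simp; linarith, by simp; linarith⟩, h2⟩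
  · rintro z ⟨h1, h2⟩; exact ⟨⟨by simp; linarith, by simp; linarith⟩, h2⟩
  · intro z b; simp [D]; ring

lemma Win.refly {A B : ℝ} {w1 w2 : ℝ × ℝ} (h : Win A B (w1.1, B - w1.2) (w2.1, B - w2.2)) :
    Win A B w1 w2 := by
  apply Win.transpose
  apply Win.reflx
  apply Win.transpose
  exact h

end VG
namespace VG

def C (A B : ℝ) (w1 w2 : ℝ × ℝ) : Set (ℝ × ℝ) := {z | z ∈ Q A B ∧ D z w1 < D z w2}

def H (A B : ℝ) (w1 w2 : ℝ × ℝ) (u v : ℝ) : Set (ℝ × ℝ) :=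
  {z | (z ∈ Q A B ∧ D z w1 < D z w2) ∧ 0 < u * (z.1 - w1.1) + v * (z.2 - w1.2)}

lemma C_meas (A B : ℝ) (w1 w2 : ℝ × ℝ) : MeasurableSet (C A B w1 w2) :=
  (Q_meas A B).inter (measurableSet_lt (D_cont w1).measurable (D_cont w2).measurable)

lemma H_meas (A B : ℝ) (w1 w2 : ℝ × ℝ) (u v : ℝ) : MeasurableSet (H A B w1 w2 u v) :=
  (C_meas A B w1 w2).inter (measurableSet_lt (f := fun _ : ℝ × ℝ => (0:ℝ))
    (g := fun z : ℝ × ℝ => u * (z.1 - w1.1) + v * (z.2 - w1.2)) (by fun_prop) (by fun_prop))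

lemma adm1 {A x u e t : ℝ} (hx : 0 ≤ x ∧ x ≤ A) (he : 0 ≤ x + e * u ∧ x + e * u ≤ A)
    (ht : 0 < t) (hte : t ≤ e) : 0 ≤ x + t * u ∧ x + t * u ≤ A := by
  rcases le_total 0 u with hu | hu
  · constructor <;> nlinarith [mul_nonneg ht.le hu, mul_nonneg (sub_nonneg.2 hte) hu]
  · constructor <;> nlinarith [mul_nonneg ht.le (neg_nonneg.2 hu), mul_nonneg (sub_nonneg.2 hte) (neg_nonneg.2 hu)]

lemma adm {A B : ℝ} {w : ℝ × ℝ} {u v e t : ℝ} (hw : w ∈ Q A B)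
    (he : (w.1 + e * u, w.2 + e * v) ∈ Q A B) (ht : 0 < t) (hte : t ≤ e) :
    (w.1 + t * u, w.2 + t * v) ∈ Q A B :=
  ⟨adm1 hw.1 he.1 ht hte, adm1 hw.2 he.2 ht hte⟩

lemma win_local {A B : ℝ} {w1 w2 : ℝ × ℝ} {u1 v1 u2 v2 e1 e2 : ℝ} (hw1 : w1 ∈ Q A B)
    (hw2 : w2 ∈ Q A B) (he1 : 0 < e1) (he2 : 0 < e2)
    (ha1 : (w1.1 + e1 * u1, w1.2 + e1 * v1) ∈ Q A B)
    (ha2 : (w2.1 + e2 * u2, w2.2 + e2 * v2) ∈ Q A B)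
    (h : ENNReal.ofReal (A * B / 2) < volume (H A B w1 w2 u1 v1 ∪ H A B w2 w1 u2 v2)) :
    Win A B w1 w2 := by
  set e := min e1 e2 with he
  have hepos : 0 < e := lt_min he1 he2
  let t : ℕ → ℝ := fun n => e / (n + 1)
  have htpos : ∀ n, 0 < t n := fun n => by positivity
  have hte : ∀ n, t n ≤ e := fun n => by
    show e / (n + 1) ≤ e
    apply div_le_self hepos.le
    have : (0:ℝ) ≤ n := Nat.cast_nonneg n
    linarith
  let S : ℕ → Set (ℝ × ℝ) := fun n =>
    {z | ((z ∈ Q A B ∧ D z w1 < D z w2) ∧ t n * (u1 ^ 2 + v1 ^ 2) / 2 < u1 * (z.1 - w1.1) + v1 * (z.2 - w1.2))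
      ∨ ((z ∈ Q A B ∧ D z w2 < D z w1) ∧ t n * (u2 ^ 2 + v2 ^ 2) / 2 < u2 * (z.1 - w2.1) + v2 * (z.2 - w2.2))}
  have hanti : ∀ m n, m ≤ n → t n ≤ t m := fun m n hmn => by
    show e / (n + 1) ≤ e / (m + 1)
    have : (m:ℝ) ≤ n := by exact_mod_cast hmn
    gcongr
  have hmono : Monotone S := by
    intro m n hmn z hz
    have h1 : t n * (u1 ^ 2 + v1 ^ 2) / 2 ≤ t m * (u1 ^ 2 + v1 ^ 2) / 2 := by
      have := hanti m n hmn; gcongr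
    have h2 : t n * (u2 ^ 2 + v2 ^ 2) / 2 ≤ t m * (u2 ^ 2 + v2 ^ 2) / 2 := by
      have := hanti m n hmn; gcongr
    rcases hz with ⟨ha, hb⟩ | ⟨ha, hb⟩
    · exact Or.inl ⟨ha, lt_of_le_of_lt h1 hb⟩
    · exact Or.inr ⟨ha, lt_of_le_of_lt h2 hb⟩
  have hlim : ∀ k x : ℝ, 0 < x → ∃ n, t n * k / 2 < x := by
    intro k x hx
    have h0 : Filter.Tendsto (fun n : ℕ => e * (1 / ((n:ℝ) + 1)) * k / 2) Filter.atTop (nhds (e * 0 * k / 2)) :=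
      (((tendsto_one_div_add_atTop_nhds_zero_nat (𝕜 := ℝ)).const_mul e).mul_const k).div_const 2
    have h1 := h0.eventually (gt_mem_nhds (show e * 0 * k / 2 < x by simpa using hx))
    obtain ⟨n, hn⟩ := h1.exists
    refine ⟨n, ?_⟩
    have : t n = e * (1 / ((n:ℝ) + 1)) := by show e / (n + 1) = _; ring
    rwa [this]
  have hU : H A B w1 w2 u1 v1 ∪ H A B w2 w1 u2 v2 ⊆ ⋃ n, S n := by
    rintro z (⟨ha, hb⟩ | ⟨ha, hb⟩)
    · obtain ⟨n, hn⟩ := hlim _ _ hb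
      exact mem_iUnion.2 ⟨n, Or.inl ⟨ha, hn⟩⟩
    · obtain ⟨n, hn⟩ := hlim _ _ hb
      exact mem_iUnion.2 ⟨n, Or.inr ⟨ha, hn⟩⟩
  have h' := lt_of_lt_of_le h (measure_mono hU)
  rw [hmono.measure_iUnion, lt_iSup_iff] at h'
  obtain ⟨n, hn⟩ := h'
  refine ⟨_, adm hw1 ha1 (htpos n) ((hte n).trans (min_le_left _ _)),
    _, adm hw2 ha2 (htpos n) ((hte n).trans (min_le_right _ _)), lt_of_lt_of_le hn (measure_mono ?_)⟩
  rintro z (⟨⟨ha, hb⟩, hc⟩ | ⟨⟨ha, hb⟩, hc⟩)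
  · refine ⟨ha, Or.inl ?_⟩
    have : D z (w1.1 + t n * u1, w1.2 + t n * v1) < D z w1 := by
      simp only [D]; nlinarith [mul_pos (htpos n) (sub_pos.2 hc)]
    exact ⟨this, this.trans hb⟩
  · refine ⟨ha, Or.inr ?_⟩
    have : D z (w2.1 + t n * u2, w2.2 + t n * v2) < D z w2 := by
      simp only [D]; nlinarith [mul_pos (htpos n) (sub_pos.2 hc)]
    exact ⟨this.trans hb, this⟩

lemma mono_line {S T : Set (ℝ × ℝ)} (u v c : ℝ) (h : u ≠ 0 ∨ v ≠ 0)
    (hST : ∀ z ∈ S, u * z.1 + v * z.2 ≠ c → z ∈ T) : volume S ≤ volume T := by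
  calc volume S ≤ volume (T ∪ {z : ℝ × ℝ | u * z.1 + v * z.2 = c}) := by
        apply measure_mono
        intro z hz
        by_cases hc : u * z.1 + v * z.2 = c
        · exact Or.inr hc
        · exact Or.inl (hST z hz hc)
    _ ≤ volume T + volume {z : ℝ × ℝ | u * z.1 + v * z.2 = c} := measure_union_le _ _
    _ = volume T := by rw [line_null u v c h, add_zero]

lemma split (A B : ℝ) (w1 w2 : ℝ × ℝ) (u v : ℝ) (h : u ≠ 0 ∨ v ≠ 0) :
    volume (C A B w1 w2) ≤ volume (H A B w1 w2 u v) + volume (H A B w1 w2 (-u) (-v)) := by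
  refine le_trans (mono_line u v (u * w1.1 + v * w1.2) h ?_) (measure_union_le _ _)
  intro z hz hc
  rcases lt_or_gt_of_ne hc with hc | hc
  · right; exact ⟨hz, by linarith⟩
  · left; exact ⟨hz, by linarith⟩

lemma exists_half {A B : ℝ} (hA : 0 < A) {w1 w2 : ℝ × ℝ} (hw1 : w1 ∈ Q A B) :
    ∃ u e : ℝ, 0 < e ∧ (w1.1 + e * u, w1.2 + e * 0) ∈ Q A B ∧
      volume (C A B w1 w2) ≤ 2 * volume (H A B w1 w2 u 0) := by
  obtain ⟨⟨h1, h2⟩, h3⟩ := hw1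
  rcases h1.eq_or_lt with h0 | h0
  · refine ⟨1, A, hA, ⟨⟨by simp; linarith, by simp; linarith⟩, by simpa using h3⟩, ?_⟩
    have : volume (C A B w1 w2) ≤ volume (H A B w1 w2 1 0) := by
      apply mono_line 1 0 0 (by simp)
      intro z hz hc
      refine ⟨hz, ?_⟩
      have := hz.1.1.1.lt_of_ne' (by simpa using hc)
      simp; linarith
    refine this.trans ?_
    rw [two_mul]; exact le_self_add
  rcases h2.eq_or_lt with h0' | h0'
  · refine ⟨-1, A, hA, ⟨⟨by simp; linarith, by simp; linarith⟩, by simpa using h3⟩, ?_⟩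
    have : volume (C A B w1 w2) ≤ volume (H A B w1 w2 (-1) 0) := by
      apply mono_line 1 0 A (by simp)
      intro z hz hc
      refine ⟨hz, ?_⟩
      have := hz.1.1.2.lt_of_ne (by simpa using hc)
      simp; linarith
    refine this.trans ?_
    rw [two_mul]; exact le_self_add
  have hs := split A B w1 w2 1 0 (by simp)
  rw [neg_zero] at hs
  rcases le_total (volume (H A B w1 w2 1 0)) (volume (H A B w1 w2 (-1) 0)) with h | h
  · refine ⟨-1, w1.1, h0, ⟨⟨by simp, by simp; linarith⟩, by simpa using h3⟩, hs.trans ?_⟩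
    rw [two_mul]; gcongr
  · refine ⟨1, A - w1.1, by linarith, ⟨⟨by simp; linarith, by simp⟩, by simpa using h3⟩, hs.trans ?_⟩
    rw [two_mul]; gcongr

lemma Q_le {A B : ℝ} (hA : 0 ≤ A) {w1 w2 : ℝ × ℝ} (hne : w1 ≠ w2) :
    ENNReal.ofReal (A * B) ≤ volume (C A B w1 w2) + volume (C A B w2 w1) := by
  rw [← Q_vol A B hA]
  refine le_trans (mono_line (w2.1 - w1.1) (w2.2 - w1.2)
    ((w2.1 ^ 2 + w2.2 ^ 2 - w1.1 ^ 2 - w1.2 ^ 2) / 2) ?_ ?_) (measure_union_le _ _)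
  · by_contra hc
    push Not at hc
    exact hne (Prod.ext (by linarith [hc.1]) (by linarith [hc.2]))
  · intro z hz hc
    have : D z w1 ≠ D z w2 := by
      intro h; apply hc; simp only [D] at h; linarith
    rcases lt_or_gt_of_ne this with h | h
    · exact Or.inl ⟨hz, h⟩
    · exact Or.inr ⟨hz, h⟩

lemma win_half {A B : ℝ} (hA : 0 < A) {w1 w2 : ℝ × ℝ} (hw1 : w1 ∈ Q A B) (hw2 : w2 ∈ Q A B)
    (hne : w1 ≠ w2) {u v e : ℝ} (he : 0 < e) (ha : (w1.1 + e * u, w1.2 + e * v) ∈ Q A B)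
    (h : volume (C A B w1 w2) < 2 * volume (H A B w1 w2 u v)) : Win A B w1 w2 := by
  obtain ⟨u', e', he', ha', h'⟩ := exists_half hA (w2 := w1) hw2
  refine win_local hw1 hw2 he he' ha ha' ?_
  rw [measure_union _ (H_meas _ _ _ _ _ _)]
  · have hfin : volume (C A B w2 w1) ≠ ⊤ := by
      apply ne_top_of_le_ne_top _ (measure_mono (fun z hz => hz.1 : C A B w2 w1 ⊆ Q A B))
      rw [Q_vol A B hA.le]; exact ENNReal.ofReal_ne_top
    have h3 : ENNReal.ofReal (A * B) < 2 * (volume (H A B w1 w2 u v) + volume (H A B w2 w1 u' 0)) := by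
      refine lt_of_le_of_lt (Q_le hA.le hne) ?_
      rw [mul_add]
      exact ENNReal.add_lt_add_of_lt_of_le hfin h h'
    have h4 : ENNReal.ofReal (A * B) = 2 * ENNReal.ofReal (A * B / 2) := by
      rw [← ENNReal.ofReal_ofNat 2, ← ENNReal.ofReal_mul (by norm_num)]; congr 1; ring
    rw [h4] at h3
    exact lt_of_mul_lt_mul_left' h3
  · rw [Set.disjoint_left]
    rintro z hz hz'
    exact lt_asymm hz.1.2 hz'.1.2

end VG
namespace VG

def K (h l k : ℝ) : Set (ℝ × ℝ) :=
  {z | (0 < z.1 ∧ z.1 < h) ∧ (0 < z.2 ∧ z.2 < l + (-k) * z.1)}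

def KH (h l k a b u v : ℝ) : Set (ℝ × ℝ) :=
  {z | z ∈ K h l k ∧ 0 < u * (z.1 - a) + v * (z.2 - b)}

lemma K_vol {h l k : ℝ} (hh : 0 < h) (hk : 0 < k) (hl : 0 ≤ l - k * h) :
    volume (K h l k) = ENNReal.ofReal (l * h - k * h ^ 2 / 2) := by
  have := area 0 h 0 0 l (-k) hh.le (by nlinarith [mul_pos hk hh]) (by linarith)
  simp only [zero_mul, add_zero] at this
  rw [K, this]; congr 1; ring

lemma bal_eq {h l k a b : ℝ} (hh : 0 < h) (hk : 0 < k) (hl : 0 ≤ l - k * h)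
    (bal : ∀ u v, 2 * volume (KH h l k a b u v) ≤ volume (K h l k))
    (u v R : ℝ) (huv : u ≠ 0 ∨ v ≠ 0) (hR : 0 ≤ R)
    (hv : volume (KH h l k a b u v) = ENNReal.ofReal R) : 2 * R = l * h - k * h ^ 2 / 2 := by
  have hs : volume (K h l k) ≤ volume (KH h l k a b u v) + volume (KH h l k a b (-u) (-v)) := by
    refine le_trans (mono_line u v (u * a + v * b) huv ?_) (measure_union_le _ _)
    intro z hz hc
    rcases lt_or_gt_of_ne hc with hc | hc
    · right; exact ⟨hz, by linarith⟩
    · left; exact ⟨hz, by linarith⟩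
  have h1 := bal u v
  have h2 := bal (-u) (-v)
  rw [K_vol hh hk hl] at *
  set E := l * h - k * h ^ 2 / 2 with hE
  have hEpos : 0 < E := by nlinarith [mul_pos hh hk, mul_nonneg hl hh.le]
  have fin2 : volume (KH h l k a b (-u) (-v)) ≠ ⊤ := by
    intro ht; rw [ht] at h2; simp at h2
  obtain ⟨R', hR', e2⟩ : ∃ R' : ℝ, 0 ≤ R' ∧ volume (KH h l k a b (-u) (-v)) = ENNReal.ofReal R' :=
    ⟨_, ENNReal.toReal_nonneg, (ENNReal.ofReal_toReal fin2).symm⟩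
  rw [hv, ← ENNReal.ofReal_ofNat 2, ← ENNReal.ofReal_mul (by norm_num),
    ENNReal.ofReal_le_ofReal_iff hEpos.le] at h1
  rw [e2, ← ENNReal.ofReal_ofNat 2, ← ENNReal.ofReal_mul (by norm_num),
    ENNReal.ofReal_le_ofReal_iff hEpos.le] at h2
  rw [hv, e2, ← ENNReal.ofReal_add hR hR', ENNReal.ofReal_le_ofReal_iff (by linarith)] at hs
  linarith

set_option maxHeartbeats 2000000 in
lemma poly {h l k a b : ℝ} (hh : 0 < h) (hk : 0 < k) (hl : 0 ≤ l - k * h)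
    (ha : 0 < a) (hah : a < h) (hb : 0 < b) (hbl : b < l - k * a)
    (bal : ∀ u v, 2 * volume (KH h l k a b u v) ≤ volume (K h l k)) : False := by
  have key := bal_eq hh hk hl bal
  have hl0 : 0 < l := by nlinarith [mul_pos hh hk]
  -- vertical line
  have e1 : 2 * (l * a - k * a ^ 2 / 2) = l * h - k * h ^ 2 / 2 := by
    apply key (-1) 0 _ (by simp)
    · nlinarith [mul_pos ha hk]
    · have := area 0 a 0 0 l (-k) ha.le (by linarith) (by linarith)
      rw [show l * a - k * a ^ 2 / 2 = (l - 0) * (a - 0) + (-k - 0) * (a ^ 2 - 0 ^ 2) / 2 by ring, ← this]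
      congr 1
      ext z
      simp only [KH, K, Set.mem_ofPred_eq]
      constructor
      · rintro ⟨⟨⟨h1, h2⟩, h3, h4⟩, h5⟩
        exact ⟨⟨h1, by linarith⟩, by linarith, h4⟩
      · rintro ⟨⟨h1, h2⟩, h3, h4⟩
        exact ⟨⟨⟨h1, by linarith⟩, by linarith, h4⟩, by linarith⟩
  have hah2 : 2 * a ≠ h := by
    intro hc
    subst hc
    nlinarith [mul_pos hk (mul_pos ha ha)]
  have e2 : ∀ s, 0 ≤ b - s * a → b - s * a ≤ l → 0 ≤ b + s * (h - a) → b + s * (h - a) ≤ l - k * h →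
      2 * ((b - s * a) * h + s * h ^ 2 / 2) = l * h - k * h ^ 2 / 2 := by
    intro s s1 s2 s3 s4
    apply key s (-1) _ (by simp)
    · nlinarith [mul_nonneg s1 hh.le, mul_nonneg s3 hh.le]
    · have := area 0 h 0 0 (b - s * a) s hh.le (by linarith) (by linarith)
      rw [show (b - s * a) * h + s * h ^ 2 / 2 = (b - s * a - 0) * (h - 0) + (s - 0) * (h ^ 2 - 0 ^ 2) / 2 by ring, ← this]
      congr 1
      ext z
      simp only [KH, K, Set.mem_ofPred_eq]
      constructor
      · rintro ⟨⟨⟨h1, h2⟩, h3, h4⟩, h5⟩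
        exact ⟨⟨h1, by linarith⟩, by linarith, by linarith⟩
      · rintro ⟨⟨h1, h2⟩, h3, h4⟩
        refine ⟨⟨⟨h1, by linarith⟩, by linarith, ?_⟩, by linarith⟩
        by_contra hc
        push Not at hc
        have t1 : 0 < (b - s * a + s * z.1) - (l + -k * z.1) := by linarith
        nlinarith [mul_pos t1 hh, mul_nonneg h1.le (sub_nonneg.2 s4), mul_nonneg (sub_nonneg.2 h2.le) (sub_nonneg.2 s2)]
  have hd : 0 < h - a := by linarith
  -- bounds
  have q1 : (b - l) / a < b / a := by gcongr; linarith
  have q2 : (b - l) / a < (l - k * h - b) / (h - a) := by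
    rw [div_lt_div_iff₀ ha hd]
    nlinarith [mul_pos hh (sub_pos.2 hbl)]
  have q3 : -b / (h - a) < b / a := by
    have : -b / (h - a) < 0 := div_neg_of_neg_of_pos (by linarith) hd
    have : 0 < b / a := by positivity
    linarith
  have chk : ∀ s, (b - l) / a ≤ s → s ≤ b / a → -b / (h - a) ≤ s → s ≤ (l - k * h - b) / (h - a) →
      2 * ((b - s * a) * h + s * h ^ 2 / 2) = l * h - k * h ^ 2 / 2 := by
    intro s s1 s2 s3 s4
    rw [div_le_iff₀ ha] at s1
    rw [le_div_iff₀ ha] at s2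
    rw [div_le_iff₀ hd] at s3
    rw [le_div_iff₀ hd] at s4
    apply e2 <;> linarith
  rcases hl.eq_or_lt with hl1 | hl1
  · have q4 : -b / (h - a) = (l - k * h - b) / (h - a) := by rw [← hl1, zero_sub]
    have e3 := chk (-b / (h - a)) (by rw [q4]; exact q2.le) q3.le le_rfl q4.le
    have hl' : l = k * h := by linarith
    subst hl'
    have e4 : 2 * b = k * (h - a) := by
      field_simp at e3
      have : h * (2 * b - k * (h - a)) = 0 := by
        have e5 := e3
        nlinarith
      rcases mul_eq_zero.1 this with h0 | h0 <;> linarith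
    -- horizontal line
    have e5 : 2 * ((k * h - b) * ((k * h - b) / k) - k * ((k * h - b) / k) ^ 2 / 2) = k * h * h - k * h ^ 2 / 2 := by
      have c0 : 0 < k * h - b := by nlinarith [mul_pos hk ha]
      have c1 : 0 < (k * h - b) / k := by positivity
      have c2 : k * ((k * h - b) / k) = k * h - b := by field_simp
      apply key 0 1 _ (by simp)
      · nlinarith
      · have := area 0 ((k * h - b) / k) b 0 (k * h) (-k) c1.le (by linarith) (by linarith)
        rw [show (k * h - b) * ((k * h - b) / k) - k * ((k * h - b) / k) ^ 2 / 2 = (k * h - b) * ((k * h - b) / k - 0) + (-k - 0) * (((k * h - b) / k) ^ 2 - 0 ^ 2) / 2 by ring, ← this]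
        congr 1
        ext z
        simp only [KH, K, Set.mem_ofPred_eq]
        constructor
        · rintro ⟨⟨⟨h1, h2⟩, h3, h4⟩, h5⟩
          refine ⟨⟨h1, ?_⟩, by linarith, by linarith⟩
          rw [lt_div_iff₀ hk]; linarith
        · rintro ⟨⟨h1, h2⟩, h3, h4⟩
          rw [lt_div_iff₀ hk] at h2
          refine ⟨⟨⟨h1, ?_⟩, by linarith, by linarith⟩, by linarith⟩
          have : z.1 * k < h * k := by linarith
          exact lt_of_mul_lt_mul_right this hk.le
    have hb' : b = k * (h - a) / 2 := by linarith
    have c3 : (k * h - b) / k = (h + a) / 2 := by rw [hb']; field_simp; ring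
    rw [c3, hb'] at e5
    have e6 : k * ((h + a) ^ 2 - 2 * h ^ 2) = 0 := by nlinarith
    have e7 : k * (2 * (h - a) ^ 2 - h ^ 2) = 0 := by nlinarith
    have e6' : (h + a) ^ 2 - 2 * h ^ 2 = 0 := by rcases mul_eq_zero.1 e6 with h0 | h0 <;> linarith
    have e7' : 2 * (h - a) ^ 2 - h ^ 2 = 0 := by rcases mul_eq_zero.1 e7 with h0 | h0 <;> linarith
    have e8 : h * (8 * a - 3 * h) = 0 := by nlinarith
    have e9 : 8 * a - 3 * h = 0 := by rcases mul_eq_zero.1 e8 with h0 | h0 <;> linarith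
    have : a = 3 * h / 8 := by linarith
    subst this
    nlinarith [mul_pos hh hh]
  · have q4 : -b / (h - a) < (l - k * h - b) / (h - a) := by gcongr; linarith
    have m1 := le_max_left ((b - l) / a) (-b / (h - a))
    have m2 := le_max_right ((b - l) / a) (-b / (h - a))
    have n1 := min_le_left (b / a) ((l - k * h - b) / (h - a))
    have n2 := min_le_right (b / a) ((l - k * h - b) / (h - a))
    have hlt : max ((b - l) / a) (-b / (h - a)) < min (b / a) ((l - k * h - b) / (h - a)) := by
      rw [max_lt_iff, lt_min_iff, lt_min_iff]; exact ⟨⟨q1, q2⟩, q3, q4⟩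
    set s := max ((b - l) / a) (-b / (h - a))
    set t := min (b / a) ((l - k * h - b) / (h - a))
    have f1 := chk s m1 (by linarith) m2 (by linarith)
    have f2 := chk t (by linarith) n1 (by linarith) n2
    have f3 : (t - s) * (h * (h - 2 * a)) = 0 := by nlinarith
    rcases mul_eq_zero.1 f3 with h0 | h0
    · linarith
    · rcases mul_eq_zero.1 h0 with h0 | h0
      · linarith
      · exact hah2 (by linarith)

end VG
namespace VG

lemma slant {A B : ℝ} (hA : 0 < A) (hB : 0 < B) {w1 w2 : ℝ × ℝ} (hw1 : w1 ∈ Q A B) (hw2 : w2 ∈ Q A B)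
    (hp : w1.1 < w2.1) (hq : w1.2 < w2.2)
    (hc : (w2.1 ^ 2 + w2.2 ^ 2 - w1.1 ^ 2 - w1.2 ^ 2) / 2 ≤ (w2.2 - w1.2) * B) : Win A B w1 w2 := by
  by_contra hW
  have hne : w1 ≠ w2 := by rintro rfl; exact lt_irrefl _ hp
  have hbal : ∀ u v e : ℝ, 0 < e → (w1.1 + e * u, w1.2 + e * v) ∈ Q A B →
      2 * volume (H A B w1 w2 u v) ≤ volume (C A B w1 w2) := by
    intro u v e he ha
    by_contra h
    push Not at h
    exact hW (win_half hA hw1 hw2 hne he ha h)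
  have hDiff : ∀ z, D z w1 < D z w2 ↔ (w2.1 - w1.1) * z.1 + (w2.2 - w1.2) * z.2 <
      (w2.1 ^ 2 + w2.2 ^ 2 - w1.1 ^ 2 - w1.2 ^ 2) / 2 := by
    intro z; simp only [D]; constructor <;> intro h <;> linarith
  obtain ⟨⟨ha0, haA⟩, hb0, hbB⟩ := hw1
  obtain ⟨⟨ha0', haA'⟩, hb0', hbB'⟩ := hw2
  have hcw := (hDiff w1).1 (by simp only [D]; nlinarith [sq_nonneg (w1.2 - w2.2), mul_pos (sub_pos.2 hp) (sub_pos.2 hp)])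
  set p := w2.1 - w1.1 with hpdef
  set q := w2.2 - w1.2 with hqdef
  set c := (w2.1 ^ 2 + w2.2 ^ 2 - w1.1 ^ 2 - w1.2 ^ 2) / 2 with hcdef
  have hp0 : 0 < p := by linarith
  have hq0 : 0 < q := by linarith
  have hc0 : 0 < c := by
    have := mul_nonneg hp0.le ha0
    have := mul_nonneg hq0.le hb0
    linarith
  set h := min A (c / p) with hh
  set l := c / q with hl
  set k := p / q with hk
  have hh0 : 0 < h := lt_min hA (by positivity)
  have hk0 : 0 < k := by positivity
  have ql : q * l = c := by rw [hl]; field_simp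
  have qk : q * k = p := by rw [hk]; field_simp
  have hph : p * h ≤ c := by
    have := min_le_right A (c / p)
    rw [← hh, le_div_iff₀ hp0] at this; linarith
  have hlk : 0 ≤ l - k * h := by
    have : 0 ≤ q * (l - k * h) := by rw [mul_sub, ← mul_assoc, ql, qk]; linarith
    exact nonneg_of_mul_nonneg_right this hq0
  have hlB : l ≤ B := by rw [hl, div_le_iff₀ hq0]; linarith
  have hylt : ∀ x y, y < l + (-k) * x ↔ p * x + q * y < c := by
    intro x y
    rw [← mul_lt_mul_iff_right₀ hq0, show q * (l + -k * x) = q * l - (q * k) * x by ring, ql, qk]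
    constructor <;> intro h <;> linarith
  have hKC : K h l k ⊆ C A B w1 w2 := by
    rintro z ⟨⟨h1, h2⟩, h3, h4⟩
    refine ⟨⟨⟨h1.le, h2.le.trans (min_le_left _ _)⟩, h3.le, ?_⟩, (hDiff z).2 ((hylt _ _).1 h4)⟩
    nlinarith [mul_pos hk0 h1]
  have hCK : volume (C A B w1 w2) ≤ volume (K h l k) := by
    calc volume (C A B w1 w2) ≤ volume {z | z ∈ C A B w1 w2 ∧ z.1 ≠ 0} := by
          apply mono_line 1 0 0 (by simp)
          intro z hz hc; exact ⟨hz, by simpa using hc⟩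
      _ ≤ volume {z | (z ∈ C A B w1 w2 ∧ z.1 ≠ 0) ∧ z.2 ≠ 0} := by
          apply mono_line 0 1 0 (by simp)
          intro z hz hc; exact ⟨hz, by simpa using hc⟩
      _ ≤ volume (K h l k) := by
          apply mono_line 1 0 A (by simp)
          rintro z ⟨⟨⟨hz1, hz2⟩, hz3⟩, hz4⟩ hc
          have e := (hDiff z).1 hz2
          have x0 : 0 < z.1 := hz1.1.1.lt_of_ne' hz3
          have y0 : 0 < z.2 := hz1.2.1.lt_of_ne' hz4
          have xA : z.1 < A := hz1.1.2.lt_of_ne (by simpa using hc)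
          refine ⟨⟨x0, lt_min xA ?_⟩, y0, (hylt _ _).2 e⟩
          rw [lt_div_iff₀ hp0]
          nlinarith [mul_pos hq0 y0]
  have hEpos : 0 < l * h - k * h ^ 2 / 2 := by
    nlinarith [mul_pos hh0 hk0, mul_nonneg hlk hh0.le, mul_pos (mul_pos hh0 hk0) hh0]
  have hKv := K_vol hh0 hk0 hlk
  have hcontra : ¬ (2 * volume (C A B w1 w2) ≤ volume (C A B w1 w2)) := by
    rw [le_antisymm hCK (measure_mono hKC), hKv, ← ENNReal.ofReal_ofNat 2,
      ← ENNReal.ofReal_mul (by norm_num), ENNReal.ofReal_le_ofReal_iff hEpos.le]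
    linarith
  have ha : 0 < w1.1 := by
    refine ha0.lt_of_ne fun h0 => hcontra ?_
    refine le_trans (mul_le_mul_right ?_ 2) (hbal 1 0 A hA ⟨⟨by simp; linarith, by simp; linarith⟩, by simpa using ⟨hb0, hbB⟩⟩)
    apply mono_line 1 0 0 (by simp)
    intro z hz hc
    have := hz.1.1.1.lt_of_ne' (by simpa using hc)
    exact ⟨hz, by simp; linarith⟩
  have hb : 0 < w1.2 := by
    refine hb0.lt_of_ne fun h0 => hcontra ?_
    refine le_trans (mul_le_mul_right ?_ 2) (hbal 0 1 B hB ⟨by simpa using ⟨ha0, haA⟩, ⟨by simp; linarith, by simp; linarith⟩⟩)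
    apply mono_line 0 1 0 (by simp)
    intro z hz hc
    have := hz.1.2.1.lt_of_ne' (by simpa using hc)
    exact ⟨hz, by simp; linarith⟩
  refine poly (a := w1.1) (b := w1.2) hh0 hk0 hlk ha (lt_min (by linarith) ?_) hb ?_ ?_
  · rw [lt_div_iff₀ hp0]; nlinarith [mul_pos hq0 hb]
  · have := (hylt w1.1 w1.2).2 hcw; linarith
  · intro u v
    have hadm : ∃ e : ℝ, 0 < e ∧ (w1.1 + e * u, w1.2 + e * v) ∈ Q A B := by
      have hcont : Continuous fun e : ℝ => ((w1.1 + e * u, w1.2 + e * v) : ℝ × ℝ) := by fun_prop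
      have hopen : IsOpen (Ioo 0 A ×ˢ Ioo 0 B) := isOpen_Ioo.prod isOpen_Ioo
      have h0 : ((w1.1 + 0 * u, w1.2 + 0 * v) : ℝ × ℝ) ∈ Ioo 0 A ×ˢ Ioo 0 B := by
        refine ⟨⟨?_, ?_⟩, ?_, ?_⟩ <;> simp <;> linarith
      have hev := hcont.continuousAt.eventually (hopen.mem_nhds h0)
      rw [Metric.eventually_nhds_iff] at hev
      obtain ⟨r, hr, hr'⟩ := hev
      have := hr' (y := r / 2) (by rw [Real.dist_eq, sub_zero, abs_of_pos (by positivity)]; linarith)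
      exact ⟨r / 2, by positivity, ⟨this.1.1.le, this.1.2.le⟩, this.2.1.le, this.2.2.le⟩
    obtain ⟨e, he, hadm⟩ := hadm
    refine le_trans (mul_le_mul_right ?_ 2) ((hbal u v e he hadm).trans hCK)
    apply measure_mono
    rintro z ⟨h1, h2⟩
    exact ⟨hKC h1, h2⟩

lemma rect_vol (x0 x1 y0 y1 : ℝ) (hx : x0 ≤ x1) (hy : y0 ≤ y1) :
    volume {z : ℝ × ℝ | (x0 < z.1 ∧ z.1 < x1) ∧ (y0 < z.2 ∧ z.2 < y1)} =
      ENNReal.ofReal ((x1 - x0) * (y1 - y0)) := by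
  have := area x0 x1 y0 0 y1 0 hx (by linarith) (by linarith)
  simp only [zero_mul, add_zero] at this
  rw [this]; congr 1; ring

lemma strip {A B : ℝ} (hA : 0 < A) (hB : 0 < B) {x1 x2 y : ℝ} (h1 : 0 ≤ x1) (h12 : x1 < x2)
    (h2 : x2 ≤ A) (hy0 : 0 ≤ y) (hyB : y ≤ B) (hW : ¬ Win A B (x1, y) (x2, y)) :
    y = B / 2 ∧ 4 * x1 = x1 + x2 := by
  have hw1 : ((x1, y) : ℝ × ℝ) ∈ Q A B := ⟨⟨h1, by simp; linarith⟩, hy0, hyB⟩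
  have hw2 : ((x2, y) : ℝ × ℝ) ∈ Q A B := ⟨⟨by simp; linarith, h2⟩, hy0, hyB⟩
  have hne : ((x1, y) : ℝ × ℝ) ≠ (x2, y) := by
    intro h; rw [Prod.mk.injEq] at h; linarith [h.1]
  set m := (x1 + x2) / 2 with hm
  have hDiff : ∀ z : ℝ × ℝ, D z (x1, y) < D z (x2, y) ↔ z.1 < m := by
    intro z
    have : D z (x2, y) - D z (x1, y) = 2 * (x2 - x1) * (m - z.1) := by simp only [D, hm]; ring
    rw [← sub_pos, this, mul_pos_iff_of_pos_left (by linarith), sub_pos]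
  have hCv : volume (C A B (x1, y) (x2, y)) ≤ ENNReal.ofReal (m * B) := by
    have : C A B (x1, y) (x2, y) ⊆ Q m B := by
      rintro z ⟨hz, hz'⟩
      exact ⟨⟨hz.1.1, ((hDiff z).1 hz').le⟩, hz.2⟩
    rw [← Q_vol m B (by linarith)]
    exact measure_mono this
  have hno : ∀ u v e a b a' b' : ℝ, 0 < e → ((x1 + e * u, y + e * v) : ℝ × ℝ) ∈ Q A B →
      0 ≤ a → a ≤ a' → a' ≤ m → 0 ≤ b → b ≤ b' → b' ≤ B →
      (∀ x' y', a < x' → x' < a' → b < y' → y' < b' → 0 < u * (x' - x1) + v * (y' - y)) →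
      2 * ((a' - a) * (b' - b)) ≤ m * B := by
    intro u v e a b a' b' he hadm g1 g2 g3 g4 g5 g6 hpos
    by_contra hcon
    push Not at hcon
    apply hW
    refine win_half hA hw1 hw2 hne he hadm (lt_of_le_of_lt hCv ?_)
    have : ENNReal.ofReal (m * B) < 2 * ENNReal.ofReal ((a' - a) * (b' - b)) := by
      rw [← ENNReal.ofReal_ofNat 2, ← ENNReal.ofReal_mul (by norm_num)]
      apply (ENNReal.ofReal_lt_ofReal_iff_of_nonneg _).2 hcon
      have : 0 ≤ m := by linarith
      positivity
    refine lt_of_lt_of_le this (mul_le_mul_right ?_ 2)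
    rw [← rect_vol a a' b b' g2 g5]
    apply measure_mono
    rintro z ⟨⟨k1, k2⟩, k3, k4⟩
    exact ⟨⟨⟨⟨by linarith, by linarith⟩, by linarith, by linarith⟩, (hDiff z).2 (by linarith)⟩,
      hpos _ _ k1 k2 k3 k4⟩
  have hm0 : 0 < m := by linarith
  have hmA : m < A := by linarith
  have hxm : x1 < m := by linarith
  have hyy : y = B / 2 := by
    rcases lt_trichotomy y (B / 2) with h | h | h
    · have := hno 0 1 (B - y) 0 y m B (by linarith) ⟨⟨by simp; linarith, by simp; linarith⟩, by simp; linarith, by simp⟩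
        le_rfl hm0.le le_rfl hy0 hyB le_rfl (by intros; linarith)
      nlinarith
    · exact h
    · have := hno 0 (-1) y 0 0 m y (by linarith) ⟨⟨by simp; linarith, by simp; linarith⟩, by simp, by simp; linarith⟩
        le_rfl hm0.le le_rfl le_rfl hy0 hyB (by intros; linarith)
      nlinarith
  refine ⟨hyy, ?_⟩
  rcases lt_trichotomy (2 * x1) m with h | h | h
  · have := hno 1 0 (A - x1) x1 0 m B (by linarith) ⟨⟨by simp; linarith, by simp⟩, by simp; linarith, by simp; linarith⟩
        h1 hxm.le le_rfl le_rfl hB.le le_rfl (by intros; linarith)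
    nlinarith
  · linarith
  · have := hno (-1) 0 x1 0 0 x1 B (by linarith) ⟨⟨by simp, by simp; linarith⟩, by simp; linarith, by simp; linarith⟩
        le_rfl h1 hxm.le le_rfl hB.le le_rfl (by intros; linarith)
    nlinarith

end VG
namespace VG

lemma reg_meas (x0 x1 f0 f1 g0 g1 : ℝ) : MeasurableSet {z : ℝ × ℝ | (x0 < z.1 ∧ z.1 < x1) ∧
    (f0 + f1 * z.1 < z.2 ∧ z.2 < g0 + g1 * z.1)} :=
  measurableSet_regionBetween (f := fun x => f0 + f1 * x) (g := fun x => g0 + g1 * x)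
    (s := Ioo x0 x1) (by fun_prop) (by fun_prop) measurableSet_Ioo

set_option maxHeartbeats 2000000 in
lemma special {A B r : ℝ} (hA : 0 < A) (hr : 0 < r) (hr3 : r * r = 3)
    (h1 : r / 2 * A < B) (h2 : r / 2 * B < A) : Win A B (A / 4, B / 2) (3 * A / 4, B / 2) := by
  obtain ⟨d, hd⟩ : ∃ d, d = (r * B / 2 - 3 * A / 4) / 4 := ⟨_, rfl⟩
  have hBd : B = (A / 2 + 8 * d / 3) * r := by
    rw [hd]; linear_combination (-B / 3) * hr3
  have hd0 : 0 < d := by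
    have := mul_lt_mul_of_pos_left h1 hr
    rw [hd]; nlinarith
  have hdA : 16 * d < A := by rw [hd]; linarith
  have hAd : 0 < A - 2 * d := by linarith
  obtain ⟨e, he⟩ : ∃ e, e = d ^ 2 / A := ⟨_, rfl⟩
  have he0 : 0 < e := by rw [he]; positivity
  have heA : A * e = d ^ 2 := by rw [he]; field_simp
  have hed : e < d := by
    rw [he, div_lt_iff₀ hA]; nlinarith
  clear he hd h1 h2
  obtain ⟨s, hs⟩ : ∃ s, s = r / 3 * ((A - 2 * d) / (2 * d)) := ⟨_, rfl⟩
  have hs0 : 0 < s := by rw [hs]; positivity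
  have hs1 : s * (2 * d) * r = A - 2 * d := by
    rw [hs]; field_simp; linear_combination hr3
  obtain ⟨X, hX⟩ : ∃ X, X = 2 * d * (A + 2 * d) / (A - 2 * d) := ⟨_, rfl⟩
  have hX0 : 0 < X := by rw [hX]; positivity
  have hX1 : X * (A - 2 * d) = 2 * d * (A + 2 * d) := by rw [hX]; field_simp
  have hsX : s * X = (A + 2 * d) * r / 3 := by rw [hs, hX]; field_simp
  have hXA : X ≤ A / 2 := by
    rw [hX, div_le_iff₀ hAd]; nlinarith [mul_pos hd0 hA]
  have hB0 : 0 < B := by rw [hBd]; positivity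
  have hrd : 0 < r * d := by positivity
  have hrA : 0 < r * A := by positivity
  have hre : 0 < r * e := by positivity
  have hred : r * e < r * d := by gcongr
  have hrdA : 16 * (r * d) < r * A := by nlinarith
  have hBd' : B = r * A / 2 + 8 * (r * d) / 3 := by rw [hBd]; ring
  refine ⟨(A / 4 + d, B / 2 + r * d), ⟨⟨by simp; linarith, by simp; linarith⟩, by simp; linarith, by simp; linarith⟩,
    (3 * A / 4 + e, B / 2 - r * e), ⟨⟨by simp; linarith, by simp; linarith⟩, by simp; linarith, by simp; linarith⟩, ?_⟩
  set S := {z : ℝ × ℝ | z ∈ Q A B ∧ ((D z (A / 4 + d, B / 2 + r * d) < D z (A / 4, B / 2) ∧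
    D z (A / 4 + d, B / 2 + r * d) < D z (3 * A / 4, B / 2)) ∨
    (D z (3 * A / 4 + e, B / 2 - r * e) < D z (A / 4, B / 2) ∧
    D z (3 * A / 4 + e, B / 2 - r * e) < D z (3 * A / 4, B / 2)))} with hS
  have a1 := area 0 (A / 2) (B / 2 + (2 * d + A / 4) * r / 3) (-(r / 3)) B 0 (by linarith)
    (by linarith) (by linarith)
  have a2 := area (A / 2) (A / 2 + X) (B / 2 + (2 * d - A / 4) * r / 3 - s * (A / 2)) s B 0
    (by linarith) (by linarith) (by linarith)
  have a3 := area (A / 2) A 0 0 (B / 2 + (-(A / 2) - A / 4 - 2 * e) * r / 3) (r / 3)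
    (by linarith) (by linarith) (by linarith)
  set T1 := {z : ℝ × ℝ | (0 < z.1 ∧ z.1 < A / 2) ∧
    (B / 2 + (2 * d + A / 4) * r / 3 + -(r / 3) * z.1 < z.2 ∧ z.2 < B + 0 * z.1)} with hT1
  set T2 := {z : ℝ × ℝ | (A / 2 < z.1 ∧ z.1 < A / 2 + X) ∧
    (B / 2 + (2 * d - A / 4) * r / 3 - s * (A / 2) + s * z.1 < z.2 ∧ z.2 < B + 0 * z.1)} with hT2
  set T3 := {z : ℝ × ℝ | (A / 2 < z.1 ∧ z.1 < A) ∧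
    (0 + 0 * z.1 < z.2 ∧ z.2 < B / 2 + (-(A / 2) - A / 4 - 2 * e) * r / 3 + r / 3 * z.1)} with hT3
  have k1 : ∀ z ∈ T1, 0 < (z.1 - A / 4) + r * (z.2 - B / 2) - 2 * d := by
    rintro z ⟨⟨z1, z2⟩, z3, z4⟩
    have := mul_pos hr (sub_pos.2 z3)
    linear_combination this - (2 * d + A / 4 - z.1) / 3 * hr3
  have k2 : ∀ z ∈ T2, 0 < -A * (z.1 - A / 2) + 2 * d * ((z.1 - A / 4) + r * (z.2 - B / 2) - 2 * d) := by
    rintro z ⟨⟨z1, z2⟩, z3, z4⟩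
    have := mul_pos (mul_pos hd0 hr) (sub_pos.2 z3)
    linear_combination 2 * this - (2 * d - A / 4) / 3 * 2 * d * hr3 - (z.1 - A / 2) * hs1
  have k3 : ∀ z ∈ T3, 0 < (z.1 - 3 * A / 4) - r * (z.2 - B / 2) - 2 * e := by
    rintro z ⟨⟨z1, z2⟩, z3, z4⟩
    have := mul_pos hr (sub_pos.2 z4)
    linear_combination this - (-(-(A / 2) - A / 4 - 2 * e) - z.1) / 3 * hr3
  have E1 : ∀ z : ℝ × ℝ, D z (A / 4, B / 2) - D z (A / 4 + d, B / 2 + r * d) =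
      2 * d * ((z.1 - A / 4) + r * (z.2 - B / 2) - 2 * d) := by
    intro z; simp only [D]; linear_combination (-d ^ 2) * hr3
  have E2 : ∀ z : ℝ × ℝ, D z (3 * A / 4, B / 2) - D z (A / 4, B / 2) = - A * (z.1 - A / 2) := by
    intro z; simp only [D]; ring
  have E3 : ∀ z : ℝ × ℝ, D z (3 * A / 4, B / 2) - D z (3 * A / 4 + e, B / 2 - r * e) =
      2 * e * ((z.1 - 3 * A / 4) - r * (z.2 - B / 2) - 2 * e) := by
    intro z; simp only [D]; linear_combination (-e ^ 2) * hr3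
  have s1 : T1 ⊆ S := by
    intro z hz
    have p := mul_pos hd0 (k1 z hz)
    have e1 := E1 z
    have e2 := E2 z
    obtain ⟨⟨z1, z2⟩, z3, z4⟩ := hz
    have p2 := mul_pos hA (sub_pos.2 z2)
    have p3 := mul_pos hr (sub_pos.2 z2)
    refine ⟨⟨⟨by linarith, by linarith⟩, by linarith, by linarith⟩, Or.inl ⟨by linarith, by linarith⟩⟩
  have s2 : T2 ⊆ S := by
    intro z hz
    have p := k2 z hz
    have e1 := E1 z
    have e2 := E2 z
    obtain ⟨⟨z1, z2⟩, z3, z4⟩ := hz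
    have p2 := mul_pos hA (sub_pos.2 z1)
    have p3 := mul_pos hs0 (sub_pos.2 z1)
    refine ⟨⟨⟨by linarith, by linarith⟩, by linarith, by linarith⟩, Or.inl ⟨by linarith, by linarith⟩⟩
  have s3 : T3 ⊆ S := by
    intro z hz
    have p := mul_pos he0 (k3 z hz)
    have e1 := E3 z
    have e2 := E2 z
    obtain ⟨⟨z1, z2⟩, z3, z4⟩ := hz
    have p2 := mul_pos hA (sub_pos.2 z1)
    have p3 := mul_pos hr (sub_pos.2 z2)
    refine ⟨⟨⟨by linarith, by linarith⟩, by linarith, by linarith⟩, Or.inr ⟨by linarith, by linarith⟩⟩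
  have m2 : MeasurableSet T2 := by
    exact reg_meas _ _ _ _ _ _
  have m3 : MeasurableSet T3 := by
    exact reg_meas _ _ _ _ _ _
  have d12 : Disjoint T1 T2 := by
    rw [Set.disjoint_left]; rintro z hz hz'; linarith [hz.1.2, hz'.1.1]
  have d123 : Disjoint (T1 ∪ T2) T3 := by
    rw [Set.disjoint_left]
    rintro z (hz | hz) hz'
    · linarith [hz.1.2, hz'.1.1]
    · have p2 := k2 z hz
      have p3 := mul_pos hd0 (k3 z hz')
      have z1 := sub_pos.2 hz.1.1
      have p4 := mul_pos z1 (show 0 < A - 4 * d by linarith)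
      have p5 := mul_pos hd0 he0
      nlinarith
  have hsub : T1 ∪ T2 ∪ T3 ⊆ S := union_subset (union_subset s1 s2) s3
  refine lt_of_lt_of_le ?_ (measure_mono hsub)
  rw [measure_union d123 m3, measure_union d12 m2, a1, a2, a3]
  have r1 : (B - (B / 2 + (2 * d + A / 4) * r / 3)) * (A / 2 - 0) + (0 - -(r / 3)) * ((A / 2) ^ 2 - 0 ^ 2) / 2
      = A * B / 4 - A * d * r / 3 := by ring
  have r2 : (B - (B / 2 + (2 * d - A / 4) * r / 3 - s * (A / 2))) * (A / 2 + X - A / 2) + (0 - s) * ((A / 2 + X) ^ 2 - (A / 2) ^ 2) / 2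
      = (A + 2 * d) * r / 3 * X / 2 := by
    linear_combination X / 2 * hBd - X / 2 * hsX
  have r3 : (B / 2 + (-(A / 2) - A / 4 - 2 * e) * r / 3 - 0) * (A - A / 2) + (r / 3 - 0) * (A ^ 2 - (A / 2) ^ 2) / 2
      = A * B / 4 - d ^ 2 * r / 3 := by linear_combination (- r / 3) * heA
  rw [r1, r2, r3]
  have hAB : A * B = r * A * A / 2 + 8 * (r * A * d) / 3 := by rw [hBd]; ring
  have n1 : 0 ≤ A * B / 4 - A * d * r / 3 := by
    nlinarith [mul_pos hrA hA, mul_pos hrA hd0]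
  have n3 : 0 ≤ A * B / 4 - d ^ 2 * r / 3 := by
    nlinarith [mul_pos hrA hA, mul_pos hrA hd0, mul_pos hrd (sub_pos.2 hdA)]
  rw [← ENNReal.ofReal_add n1 (by positivity), ← ENNReal.ofReal_add (by positivity) n3]
  apply (ENNReal.ofReal_lt_ofReal_iff_of_nonneg (by positivity)).2
  have hfin : 2 * d * (A + d) < (A + 2 * d) * X := by
    have hXd : 2 * d < X := by
      rw [hX, lt_div_iff₀ hAd]; nlinarith
    nlinarith
  nlinarith [mul_pos hr (sub_pos.2 hfin)]

lemma L0 {A B r : ℝ} (hA : 0 < A) (hB : 0 < B) (hr : 0 < r) (hr3 : r * r = 3)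
    (h1 : r / 2 * A < B) (h2 : r / 2 * B < A) {x1 x2 y : ℝ} (hw1 : (x1, y) ∈ Q A B)
    (hw2 : (x2, y) ∈ Q A B) (h : x1 < x2) : Win A B (x1, y) (x2, y) := by
  by_contra hW
  obtain ⟨⟨a1, a2⟩, a3, a4⟩ := hw1
  obtain ⟨⟨b1, b2⟩, b3, b4⟩ := hw2
  simp only at a1 a2 a3 a4 b1 b2
  have s1 := strip hA hB a1 h b2 a3 a4 hW
  have hW' : ¬ Win A B (A - x2, y) (A - x1, y) := fun hh => hW (Win.reflx hh.swap)
  have s2 := strip hA hB (by linarith) (by linarith) (by linarith) a3 a4 hW'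
  apply hW
  have e1 : x1 = A / 4 := by linarith [s1.2, s2.2]
  have e2 : x2 = 3 * A / 4 := by linarith [s1.2, s2.2]
  rw [e1, e2, s1.1]
  exact special hA hr hr3 h1 h2

lemma L1 {A B : ℝ} (hA : 0 < A) (hB : 0 < B) {w1 w2 : ℝ × ℝ} (hw1 : w1 ∈ Q A B) (hw2 : w2 ∈ Q A B)
    (hp : w1.1 < w2.1) (hq : w1.2 < w2.2) : Win A B w1 w2 := by
  by_cases hc : (w2.1 ^ 2 + w2.2 ^ 2 - w1.1 ^ 2 - w1.2 ^ 2) / 2 ≤ (w2.2 - w1.2) * B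
  · exact slant hA hB hw1 hw2 hp hq hc
  by_cases hc' : (w2.1 ^ 2 + w2.2 ^ 2 - w1.1 ^ 2 - w1.2 ^ 2) / 2 ≤ (w2.1 - w1.1) * A
  · apply Win.transpose
    refine slant hB hA ⟨hw1.2, hw1.1⟩ ⟨hw2.2, hw2.1⟩ hq hp ?_
    simp only [Prod.fst_swap, Prod.snd_swap]
    linarith
  · apply Win.reflx
    apply Win.refly
    apply Win.swap
    obtain ⟨⟨a1, a2⟩, a3, a4⟩ := hw1
    obtain ⟨⟨b1, b2⟩, b3, b4⟩ := hw2
    refine slant hA hB ⟨⟨by simp; linarith, by simp; linarith⟩, by simp; linarith, by simp; linarith⟩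
      ⟨⟨by simp; linarith, by simp; linarith⟩, by simp; linarith, by simp; linarith⟩ (by simp; linarith) (by simp; linarith) ?_
    simp only
    push Not at hc hc'
    nlinarith

lemma L2 {A B r : ℝ} (hA : 0 < A) (hB : 0 < B) (hr : 0 < r) (hr3 : r * r = 3)
    (h1 : r / 2 * A < B) (h2 : r / 2 * B < A) {w1 w2 : ℝ × ℝ} (hw1 : w1 ∈ Q A B)
    (hw2 : w2 ∈ Q A B) (h : w1.1 < w2.1) : Win A B w1 w2 := by
  rcases lt_trichotomy w1.2 w2.2 with hy | hy | hy
  · exact L1 hA hB hw1 hw2 h hy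
  · obtain ⟨x1, y1⟩ := w1
    obtain ⟨x2, y2⟩ := w2
    simp only at hy h
    subst hy
    exact L0 hA hB hr hr3 h1 h2 hw1 hw2 h
  · apply Win.refly
    obtain ⟨a, a3, a4⟩ := hw1
    obtain ⟨b, b3, b4⟩ := hw2
    exact L1 hA hB ⟨a, by simp; linarith, by simp; linarith⟩ ⟨b, by simp; linarith, by simp; linarith⟩ h (by simp; linarith)

lemma game {A B r : ℝ} (hA : 0 < A) (hB : 0 < B) (hr : 0 < r) (hr3 : r * r = 3)
    (h1 : r / 2 * A < B) (h2 : r / 2 * B < A) {w1 w2 : ℝ × ℝ} (hw1 : w1 ∈ Q A B)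
    (hw2 : w2 ∈ Q A B) (h : w1 ≠ w2) : Win A B w1 w2 := by
  rcases lt_trichotomy w1.1 w2.1 with hx | hx | hx
  · exact L2 hA hB hr hr3 h1 h2 hw1 hw2 hx
  · apply Win.transpose
    rcases lt_trichotomy w1.2 w2.2 with hy | hy | hy
    · exact L2 hB hA hr hr3 h2 h1 ⟨hw1.2, hw1.1⟩ ⟨hw2.2, hw2.1⟩ hy
    · exact absurd (Prod.ext hx hy) h
    · exact (L2 hB hA hr hr3 h2 h1 ⟨hw2.2, hw2.1⟩ ⟨hw1.2, hw1.1⟩ hy).swap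
  · exact (L2 hA hB hr hr3 h1 h2 hw2 hw1 hx).swap

lemma dist_lt_iff (q : EuclideanSpace ℝ (Fin 2)) (b w : EuclideanSpace ℝ (Fin 2)) :
    dist q b < dist q w ↔ D (q 0, q 1) (b 0, b 1) < D (q 0, q 1) (w 0, w 1) := by
  rw [EuclideanSpace.dist_eq, EuclideanSpace.dist_eq, Real.sqrt_lt_sqrt_iff (by positivity)]
  simp [D, Fin.sum_univ_two, Real.dist_eq, sq_abs]

lemma mp_coord : MeasurePreserving (fun q : EuclideanSpace ℝ (Fin 2) => ((q 0, q 1) : ℝ × ℝ)) volume volume :=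
  (volume_preserving_finTwoArrow ℝ).comp (PiLp.volume_preserving_ofLp (Fin 2))

lemma win_distinct {A B : ℝ} (hA : 0 < A) {w1 w2 : ℝ × ℝ} (h : Win A B w1 w2) :
    ∃ b1 ∈ Q A B, ∃ b2 ∈ Q A B, b1 ≠ b2 ∧ ENNReal.ofReal (A * B / 2) <
    volume {z : ℝ × ℝ | z ∈ Q A B ∧ ((D z b1 < D z w1 ∧ D z b1 < D z w2) ∨
      (D z b2 < D z w1 ∧ D z b2 < D z w2))} := by
  obtain ⟨b1, h1, b2, h2, h⟩ := h
  by_cases hb : b1 = b2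
  · subst hb
    obtain ⟨b, hbQ, hne⟩ : ∃ b ∈ Q A B, b1 ≠ b := by
      have hB : 0 ≤ B := h1.2.1.trans h1.2.2
      by_cases h0 : b1 = (0, 0)
      · refine ⟨(A, 0), ⟨⟨hA.le, le_rfl⟩, le_rfl, hB⟩, ?_⟩
        rw [h0]; intro hc; rw [Prod.mk.injEq] at hc; linarith [hc.1]
      · exact ⟨(0, 0), ⟨⟨le_rfl, hA.le⟩, le_rfl, hB⟩, h0⟩
    refine ⟨b1, h1, b, hbQ, hne, lt_of_lt_of_le h (measure_mono ?_)⟩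
    rintro z ⟨hz, hz'⟩
    exact ⟨hz, Or.inl (by tauto)⟩
  · exact ⟨b1, h1, b2, h2, hb, h⟩

end VG

/-- For `√3/2 < ρ ≤ 1`, Barney wins the two-point game: against any two white
points he can place two black points claiming strictly more than half the board. -/
theorem stmt_2 (ρ : ℝ) (hρ1 : Real.sqrt 3 / 2 < ρ) (hρ2 : ρ ≤ 1)
    (W : Set (EuclideanSpace ℝ (Fin 2))) (hWQ : W ⊆ board ρ) (hWfin : W.Finite)
    (hWcard : W.ncard = 2) :
    ∃ B : Set (EuclideanSpace ℝ (Fin 2)), B ⊆ board ρ ∧ B.Finite ∧ B.ncard = 2 ∧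
      volume {q | q ∈ board ρ ∧ infDist q B < infDist q W} > ENNReal.ofReal (ρ / 2) := by
  have hr3 : Real.sqrt 3 * Real.sqrt 3 = 3 := Real.mul_self_sqrt (by norm_num)
  have hr : 0 < Real.sqrt 3 := Real.sqrt_pos.2 (by norm_num)
  have hρ0 : 0 < ρ := by linarith
  have hlt : Real.sqrt 3 / 2 * ρ < 1 := by nlinarith
  obtain ⟨p1, p2, hne, rfl⟩ := Set.ncard_eq_two.1 hWcard
  have hp1 := hWQ (show p1 ∈ ({p1, p2} : Set _) by simp)
  have hp2 := hWQ (show p2 ∈ ({p1, p2} : Set _) by simp)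
  have hne' : ((p1 0, p1 1) : ℝ × ℝ) ≠ (p2 0, p2 1) := by
    intro h
    rw [Prod.mk.injEq] at h
    apply hne
    ext i
    fin_cases i
    · exact h.1
    · exact h.2
  have hwin := VG.game (A := 1) (B := ρ) one_pos hρ0 hr hr3 (by linarith) hlt
    (w1 := (p1 0, p1 1)) (w2 := (p2 0, p2 1)) hp1 hp2 hne'
  obtain ⟨b1, h1, b2, h2, hb, h⟩ := VG.win_distinct one_pos hwin
  have c0 : ∀ x y : ℝ, (pt x y) 0 = x := fun x y => rfl
  have c1 : ∀ x y : ℝ, (pt x y) 1 = y := fun x y => rfl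
  have hbne : pt b1.1 b1.2 ≠ pt b2.1 b2.2 := by
    intro hc
    apply hb
    apply Prod.ext
    · rw [← c0 b1.1 b1.2, hc, c0]
    · rw [← c1 b1.1 b1.2, hc, c1]
  refine ⟨{pt b1.1 b1.2, pt b2.1 b2.2}, ?_, by simp, Set.ncard_pair hbne, ?_⟩
  · rintro q (rfl | rfl)
    · exact h1
    · exact h2
  · rw [one_mul] at h
    refine lt_of_lt_of_le h ?_
    rw [← VG.mp_coord.measure_preimage (VG.win_meas _ _ _ _ _ _).nullMeasurableSet]
    apply measure_mono
    rintro q ⟨hq, hq'⟩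
    refine ⟨hq, ?_⟩
    have hB : ∀ b ∈ ({pt b1.1 b1.2, pt b2.1 b2.2} : Set (EuclideanSpace ℝ (Fin 2))),
        dist q b < dist q p1 → dist q b < dist q p2 →
        infDist q {pt b1.1 b1.2, pt b2.1 b2.2} < infDist q {p1, p2} := by
      intro b hb d1 d2
      refine lt_of_le_of_lt (infDist_le_dist_of_mem hb) ?_
      obtain ⟨y, hy, hy'⟩ := hWfin.isCompact.exists_infDist_eq_dist (by simp) q
      rw [hy']
      rcases hy with rfl | rfl
      · exact d1
      · exact d2
    rcases hq' with ⟨k1, k2⟩ | ⟨k1, k2⟩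
    · exact hB (pt b1.1 b1.2) (by simp) ((VG.dist_lt_iff _ _ _).2 k1) ((VG.dist_lt_iff _ _ _).2 k2)
    · exact hB (pt b2.1 b2.2) (by simp) ((VG.dist_lt_iff _ _ _).2 k1) ((VG.dist_lt_iff _ _ _).2 k2)
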